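/- There exists a constant C depending only on n such that for every integer j ≥ 0, ∫₀^∞ ((c_j φ_j(x))² + (c_j φ_j'(x))²) w(x) dx ≤ C (1 + |λ_j|). -/

import Mathlib

open Set MeasureTheory

open Polynomial Filter Topology

/-- The moment `∫₀^∞ y ^ s * p y * exp (-y ^ 2 / 4)` of a polynomial `p`. -/
noncomputable def gaussMoment (s : ℝ) (p : ℝ[X]) : ℝ :=
  ∫ y in Ioi (0 : ℝ), y ^ s * p.eval y * Real.exp (-y ^ 2 / 4)

theorem integrableOn_rpow_mul_eval_mul_exp {s : ℝ} (hs : -1 < s) (p : ℝ[X]) :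
    IntegrableOn (fun y : ℝ => y ^ s * p.eval y * Real.exp (-y ^ 2 / 4)) (Ioi 0) := by
  induction p using Polynomial.induction_on' with
  | add p q hp hq =>
    refine (hp.add hq).congr_fun (fun y _ => ?_) measurableSet_Ioi
    simp only [Pi.add_apply, eval_add]
    ring
  | monomial m a =>
    have hm : -1 < s + m := by
      have : (0 : ℝ) ≤ m := m.cast_nonneg
      linarith
    refine IntegrableOn.congr_fun (Integrable.const_mul
      (integrableOn_rpow_mul_exp_neg_mul_sq (b := 1 / 4) (by norm_num) hm) a)
      (fun y (hy : 0 < y) => ?_) measurableSet_Ioi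
    simp only [eval_monomial]
    rw [Real.rpow_add hy, Real.rpow_natCast, show -(1 / 4 : ℝ) * y ^ 2 = -y ^ 2 / 4 by ring]
    ring

theorem gaussMoment_add {s : ℝ} (hs : -1 < s) (p q : ℝ[X]) :
    gaussMoment s (p + q) = gaussMoment s p + gaussMoment s q := by
  unfold gaussMoment
  rw [← integral_add (integrableOn_rpow_mul_eval_mul_exp hs p)
    (integrableOn_rpow_mul_eval_mul_exp hs q)]
  refine setIntegral_congr_fun measurableSet_Ioi fun y _ => ?_
  simp only [eval_add]
  ring

theorem gaussMoment_C_mul (s a : ℝ) (p : ℝ[X]) :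
    gaussMoment s (C a * p) = a * gaussMoment s p := by
  unfold gaussMoment
  rw [← integral_const_mul]
  refine setIntegral_congr_fun measurableSet_Ioi fun y _ => ?_
  simp only [eval_mul, eval_C]
  ring

theorem gaussMoment_X_mul (s : ℝ) (p : ℝ[X]) :
    gaussMoment s (X * p) = gaussMoment (s + 1) p := by
  unfold gaussMoment
  refine setIntegral_congr_fun measurableSet_Ioi fun y (hy : 0 < y) => ?_
  simp only [eval_mul, eval_X]
  rw [Real.rpow_add_one hy.ne']
  ring

theorem gaussMoment_sq_nonneg (s : ℝ) (p : ℝ[X]) : 0 ≤ gaussMoment s (p ^ 2) := by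
  refine setIntegral_nonneg measurableSet_Ioi fun y (hy : 0 < y) => ?_
  simp only [eval_pow]
  positivity

theorem tendsto_rpow_mul_eval_mul_exp_atTop (s : ℝ) (p : ℝ[X]) :
    Tendsto (fun y : ℝ => y ^ s * p.eval y * Real.exp (-y ^ 2 / 4)) atTop (𝓝 0) := by
  induction p using Polynomial.induction_on' with
  | add p q hp hq =>
    have h := hp.add hq
    rw [add_zero] at h
    refine h.congr fun y => ?_
    simp only [eval_add]
    ring
  | monomial m a =>
    have h := (rpow_mul_exp_neg_mul_sq_isLittleO_exp_neg (b := 1 / 4) (by norm_num)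
      (s + m)).trans_tendsto (Real.tendsto_exp_atBot.comp
        (tendsto_id.const_mul_atTop_of_neg (by norm_num : -(1 / 2 : ℝ) < 0)))
    have h' := h.const_mul a
    rw [mul_zero] at h'
    refine h'.congr' ?_
    filter_upwards [eventually_gt_atTop 0] with y hy
    simp only [eval_monomial]
    rw [Real.rpow_add hy, Real.rpow_natCast, show -(1 / 4 : ℝ) * y ^ 2 = -y ^ 2 / 4 by ring]
    ring

/-- Integration by parts for `gaussMoment`. -/
theorem gaussMoment_integration_by_parts {s : ℝ} (hs : 0 < s) (p : ℝ[X]) :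
    gaussMoment s (derivative p) + s * gaussMoment (s - 1) p
      - gaussMoment (s + 1) p / 2 = 0 := by
  have i₁ := integrableOn_rpow_mul_eval_mul_exp (by linarith : -1 < s) (derivative p)
  have i₂ := (integrableOn_rpow_mul_eval_mul_exp (by linarith : -1 < s - 1) p).const_mul s
  have i₃ := (integrableOn_rpow_mul_eval_mul_exp (by linarith : -1 < s + 1) p).div_const 2
  have hderiv : ∀ y ∈ Ioi (0 : ℝ),
      HasDerivAt (fun y : ℝ => y ^ s * p.eval y * Real.exp (-y ^ 2 / 4))
        (y ^ s * (derivative p).eval y * Real.exp (-y ^ 2 / 4)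
          + s * (y ^ (s - 1) * p.eval y * Real.exp (-y ^ 2 / 4))
          - y ^ (s + 1) * p.eval y * Real.exp (-y ^ 2 / 4) / 2) y := by
    intro y hy
    have hy0 : y ≠ 0 := ne_of_gt hy
    have he : HasDerivAt (fun y : ℝ => Real.exp (-y ^ 2 / 4))
        (Real.exp (-y ^ 2 / 4) * (-(2 * y) / 4)) y := by
      have := (((hasDerivAt_pow 2 y).neg).div_const 4).exp
      simpa using this
    refine (((Real.hasDerivAt_rpow_const (p := s) (Or.inl hy0)).fun_mul
      (p.hasDerivAt y)).fun_mul he).congr_deriv ?_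
    rw [Real.rpow_add_one hy0]
    ring
  have hcont : ContinuousWithinAt (fun y : ℝ => y ^ s * p.eval y * Real.exp (-y ^ 2 / 4))
      (Ici 0) 0 := by
    refine ContinuousAt.continuousWithinAt ?_
    refine ((Real.continuousAt_rpow_const 0 s (Or.inr hs.le)).mul p.continuousAt).mul ?_
    fun_prop
  have key := integral_Ioi_of_hasDerivAt_of_tendsto hcont hderiv ((i₁.add i₂).sub i₃)
    (tendsto_rpow_mul_eval_mul_exp_atTop s p)
  have hsub := integral_sub (i₁.add i₂) i₃
  have hadd := integral_add i₁ i₂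
  rw [integral_const_mul] at hadd
  rw [integral_div] at hsub
  simp only [Pi.add_apply] at hsub
  rw [hadd] at hsub
  rw [Real.zero_rpow hs.ne', zero_mul, zero_mul, sub_zero] at key
  exact hsub.symm.trans key

/-- The coefficients of the Kummer polynomial `M(-j, b; x)`. -/
noncomputable def kummerCoeff (b : ℝ) (j m : ℕ) : ℝ :=
  (-1 : ℝ) ^ m * (j.choose m : ℝ) / ∏ k ∈ Finset.range m, (b + (k : ℝ))

/-- The Kummer polynomial `M(-j, b; X)`. -/
noncomputable def kummerPoly (b : ℝ) (j : ℕ) : ℝ[X] :=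
  ∑ m ∈ Finset.range (j + 1), monomial m (kummerCoeff b j m)

theorem coeff_kummerPoly (b : ℝ) (j m : ℕ) : (kummerPoly b j).coeff m = kummerCoeff b j m := by
  simp only [kummerPoly, finsetSum_coeff, coeff_monomial, Finset.sum_ite_eq', Finset.mem_range]
  split_ifs with h
  · rfl
  · simp [kummerCoeff, Nat.choose_eq_zero_of_lt (by omega : j < m)]

theorem kummerCoeff_succ {b : ℝ} (hb : 0 < b) (j m : ℕ) :
    kummerCoeff b j (m + 1) * ((m + 1) * (b + m)) = ((m : ℝ) - j) * kummerCoeff b j m := by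
  have hprod : ∏ k ∈ Finset.range m, (b + (k : ℝ)) ≠ 0 :=
    Finset.prod_ne_zero_iff.mpr fun k _ => by positivity
  have hbm : b + (m : ℝ) ≠ 0 := by positivity
  have hch : (j.choose (m + 1) : ℝ) * (m + 1) = j.choose m * ((j : ℝ) - m) := by
    rcases le_or_gt m j with h | h
    · have := Nat.choose_succ_right_eq j m
      rw [← Nat.cast_sub h]
      exact_mod_cast this
    · simp [Nat.choose_eq_zero_of_lt h, Nat.choose_eq_zero_of_lt (h.trans (Nat.lt_succ_self m))]
  unfold kummerCoeff
  rw [Finset.prod_range_succ, pow_succ]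
  field_simp
  linear_combination -hch

/-- Kummer's differential equation. -/
theorem kummerPoly_ode {b : ℝ} (hb : 0 < b) (j : ℕ) :
    X * derivative (derivative (kummerPoly b j)) + (C b - X) * derivative (kummerPoly b j)
      + C (j : ℝ) * kummerPoly b j = 0 := by
  ext m
  have h := kummerCoeff_succ hb j m
  cases m with
  | zero =>
    simp [sub_mul, coeff_derivative, coeff_kummerPoly] at h ⊢
    linear_combination h
  | succ m =>
    simp [sub_mul, coeff_derivative, coeff_kummerPoly] at h ⊢
    linear_combination h

/-- The even polynomial `M(-j, b; X ^ 2 / 4)`. -/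
noncomputable def kummerSq (b : ℝ) (j : ℕ) : ℝ[X] :=
  (kummerPoly b j).comp (C (1 / 4) * X ^ 2)

theorem kummerSq_ode {b : ℝ} (hb : 0 < b) (j : ℕ) :
    X * derivative (derivative (kummerSq b j)) + C (2 * b - 1) * derivative (kummerSq b j)
      - C (1 / 2) * X ^ 2 * derivative (kummerSq b j) + C (j : ℝ) * X * kummerSq b j = 0 := by
  have h := congrArg (fun q => q.comp (C (1 / 4 : ℝ) * X ^ 2)) (kummerPoly_ode hb j)
  simp only [add_comp, mul_comp, sub_comp, X_comp, C_comp, zero_comp] at h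
  have hd : derivative (C (1 / 4 : ℝ) * X ^ 2) = C (1 / 2) * X := by
    rw [derivative_C_mul, derivative_X_pow, ← mul_assoc, ← C_mul]
    norm_num
  simp only [kummerSq, derivative_comp, derivative_mul, hd, derivative_C, derivative_X]
  apply Polynomial.funext
  intro y
  have hy := congrArg (eval y) h
  simp at hy ⊢
  linear_combination y * hy

theorem eval_kummerSq (b : ℝ) (j : ℕ) (y : ℝ) :
    (kummerSq b j).eval y = ∑ m ∈ Finset.range (j + 1),
      (-1 : ℝ) ^ m * (j.choose m : ℝ) * (y ^ 2 / 4) ^ m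
        / ∏ k ∈ Finset.range m, (b + (k : ℝ)) := by
  simp only [kummerSq, kummerPoly, eval_comp, eval_finsetSum, eval_monomial, kummerCoeff,
    eval_mul, eval_C, eval_pow, eval_X]
  refine Finset.sum_congr rfl fun m _ => ?_
  rw [show 1 / 4 * y ^ 2 = y ^ 2 / 4 by ring]
  ring

theorem gaussMoment_derivative_kummerSq_sq {b : ℝ} (hb : 1 < b) (j : ℕ) :
    gaussMoment (2 * b - 1) (derivative (kummerSq b j) ^ 2)
      = j * gaussMoment (2 * b - 1) (kummerSq b j ^ 2) := by
  set p := kummerSq b j with hp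
  have hibp := gaussMoment_integration_by_parts (by linarith : 0 < 2 * b - 1) (p * derivative p)
  have hs : -1 < 2 * b - 1 - 1 := by linarith
  have e : 2 * b - 1 = (2 * b - 1 - 1) + 1 := by ring
  have hpoly : X * derivative (p * derivative p) + (C (2 * b - 1) * (p * derivative p)
      + C (-1 / 2) * (X * (X * (p * derivative p))))
      = X * derivative p ^ 2 + C (-(j : ℝ)) * (X * p ^ 2) := by
    have ode := kummerSq_ode (by linarith : 0 < b) j
    rw [← hp] at ode
    apply Polynomial.funext
    intro y
    have hy := congrArg (eval y) ode
    simp at hy ⊢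
    linear_combination p.eval y * hy
  have h := congrArg (gaussMoment (2 * b - 1 - 1)) hpoly
  rw [gaussMoment_add hs, gaussMoment_add hs, gaussMoment_add hs] at h
  simp only [gaussMoment_C_mul, gaussMoment_X_mul] at h
  rw [← e] at h
  linarith

/-- Expansion of the weighted integral of `(y ^ a * p)' ^ 2`. -/
theorem gaussMoment_add_X_mul_derivative_sq {b : ℝ} (hb : 1 < b) (a : ℝ) (p : ℝ[X]) :
    gaussMoment (2 * b - 3) ((C a * p + X * derivative p) ^ 2)
      = (a ^ 2 - a * (2 * b - 2)) * gaussMoment (2 * b - 3) (p ^ 2)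
        + a / 2 * gaussMoment (2 * b - 1) (p ^ 2)
        + gaussMoment (2 * b - 1) (derivative p ^ 2) := by
  have hibp := gaussMoment_integration_by_parts (by linarith : 0 < 2 * b - 2) (p ^ 2)
  have hs : -1 < 2 * b - 3 := by linarith
  have e₁ : 2 * b - 3 + 1 = 2 * b - 2 := by ring
  have e₂ : 2 * b - 2 + 1 = 2 * b - 1 := by ring
  have e₃ : 2 * b - 2 - 1 = 2 * b - 3 := by ring
  have hpoly : (C a * p + X * derivative p) ^ 2
      = C (a ^ 2) * p ^ 2 + (C a * (X * derivative (p ^ 2)) + X * (X * derivative p ^ 2)) := by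
    apply Polynomial.funext
    intro y
    simp [derivative_pow]
    ring
  rw [hpoly, gaussMoment_add hs, gaussMoment_add hs]
  simp only [gaussMoment_C_mul, gaussMoment_X_mul, e₁, e₂, e₃] at hibp ⊢
  linear_combination a * hibp

/-- A Hardy inequality for polynomials with Gaussian weight. -/
theorem gaussMoment_hardy {b : ℝ} (hb : 1 < b) (p : ℝ[X]) :
    (b - 1) ^ 2 * gaussMoment (2 * b - 3) (p ^ 2)
      ≤ (b - 1) / 2 * gaussMoment (2 * b - 1) (p ^ 2)
        + gaussMoment (2 * b - 1) (derivative p ^ 2) := by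
  have h := gaussMoment_add_X_mul_derivative_sq hb (b - 1) p
  have h0 := gaussMoment_sq_nonneg (2 * b - 3) (C (b - 1) * p + X * derivative p)
  linarith

theorem stmt_4 (n : ℕ) (hn : 8 ≤ n)
    (α b : ℝ)
    (hα : α = (3 - (n : ℝ) + Real.sqrt ((n : ℝ) ^ 2 - 10 * (n : ℝ) + 17)) / 2)
    (hb : b = α + ((n : ℝ) - 1) / 2)
    (lam : ℕ → ℝ) (hlam : ∀ i : ℕ, lam i = -(1 - α) / 2 + (i : ℝ))
    (φ : ℕ → ℝ → ℝ)
    (hφ : ∀ (i : ℕ) (y : ℝ), φ i y = y ^ α * ∑ m ∈ Finset.range (i + 1),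
      (-1 : ℝ) ^ m * (i.choose m : ℝ) * (y ^ 2 / 4) ^ m
        / ∏ k ∈ Finset.range m, (b + (k : ℝ)))
    (w : ℝ → ℝ)
    (hw : ∀ y : ℝ, w y = y ^ ((n : ℝ) - 2) * Real.exp (-y ^ 2 / 4)) :
    ∃ C : ℝ, ∀ (j : ℕ) (c : ℝ), 0 < c →
      (∫ y in Ioi (0 : ℝ), (c * φ j y) ^ 2 * w y) = 1 →
      ∫ x in Ioi (0 : ℝ), ((c * φ j x) ^ 2 + (c * deriv (φ j) x) ^ 2) * w x
        ≤ C * (1 + |lam j|) := by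
  have hn' : (8 : ℝ) ≤ n := by exact_mod_cast hn
  have hD : 0 < (n : ℝ) ^ 2 - 10 * (n : ℝ) + 17 := by nlinarith
  have hb1 : 1 < b := by
    have := Real.sqrt_pos.mpr hD
    rw [hb, hα]
    linarith
  have hα0 : α < 0 := by
    have : Real.sqrt ((n : ℝ) ^ 2 - 10 * (n : ℝ) + 17) < n - 3 := by
      rw [Real.sqrt_lt' (by linarith)]
      nlinarith
    rw [hα]
    linarith
  have hφ' : ∀ j, φ j = fun y => y ^ α * (kummerSq b j).eval y := fun j => by
    funext y
    rw [hφ, eval_kummerSq]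
  have hsq : ∀ (j : ℕ) (c : ℝ), ∀ y ∈ Ioi (0 : ℝ), (c * φ j y) ^ 2 * w y
      = c ^ 2 * (y ^ (2 * b - 1) * (kummerSq b j ^ 2).eval y * Real.exp (-y ^ 2 / 4)) := by
    intro j c y hy
    have hy0 : 0 < y := hy
    rw [hφ', hw, show 2 * b - 1 = α + α + ((n : ℝ) - 2) by rw [hb]; ring,
      Real.rpow_add hy0, Real.rpow_add hy0, eval_pow]
    ring
  have hdsq : ∀ (j : ℕ) (c : ℝ), ∀ y ∈ Ioi (0 : ℝ), (c * deriv (φ j) y) ^ 2 * w y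
      = c ^ 2 * (y ^ (2 * b - 3) * ((C α * kummerSq b j + X * derivative (kummerSq b j)) ^ 2).eval y
        * Real.exp (-y ^ 2 / 4)) := by
    intro j c y hy
    have hy0 : 0 < y := hy
    have hd : deriv (φ j) y
        = y ^ (α - 1) * (C α * kummerSq b j + X * derivative (kummerSq b j)).eval y := by
      rw [hφ', ((Real.hasDerivAt_rpow_const (p := α) (Or.inl hy0.ne')).fun_mul
        ((kummerSq b j).hasDerivAt y)).deriv]
      have : y ^ α = y ^ (α - 1) * y := by
        rw [← Real.rpow_add_one hy0.ne', sub_add_cancel]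
      rw [this]
      simp
      ring
    rw [hd, hw, show 2 * b - 3 = (α - 1) + (α - 1) + ((n : ℝ) - 2) by rw [hb]; ring,
      Real.rpow_add hy0, Real.rpow_add hy0, eval_pow]
    ring
  set K := (α ^ 2 - α * (2 * b - 2)) / (b - 1) ^ 2 with hK
  have hb2 : 0 < (b - 1) ^ 2 := by
    have : 0 < b - 1 := by linarith
    positivity
  have hKα : 0 ≤ α ^ 2 - α * (2 * b - 2) := by nlinarith
  have hK0 : 0 ≤ K := div_nonneg hKα hb2.le
  have hKb : 0 ≤ K * ((b - 1) / 2) := mul_nonneg hK0 (by linarith)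
  refine ⟨1 + K * ((b - 1) / 2) + (K + 1) * (1 + (1 - α) / 2), fun j c hc hnorm => ?_⟩
  rw [setIntegral_congr_fun measurableSet_Ioi (hsq j c), integral_const_mul] at hnorm
  have hcongr : ∀ y ∈ Ioi (0 : ℝ), ((c * φ j y) ^ 2 + (c * deriv (φ j) y) ^ 2) * w y
      = c ^ 2 * (y ^ (2 * b - 1) * (kummerSq b j ^ 2).eval y * Real.exp (-y ^ 2 / 4))
        + c ^ 2 * (y ^ (2 * b - 3)
          * ((C α * kummerSq b j + X * derivative (kummerSq b j)) ^ 2).eval y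
          * Real.exp (-y ^ 2 / 4)) := by
    intro y hy
    rw [← hsq j c y hy, ← hdsq j c y hy]
    ring
  rw [setIntegral_congr_fun measurableSet_Ioi hcongr, integral_add
    ((integrableOn_rpow_mul_eval_mul_exp (by linarith) _).const_mul _)
    ((integrableOn_rpow_mul_eval_mul_exp (by linarith) _).const_mul _),
    integral_const_mul, integral_const_mul, hnorm]
  change 1 + c ^ 2 * gaussMoment (2 * b - 3) _ ≤ _
  change c ^ 2 * gaussMoment (2 * b - 1) _ = 1 at hnorm
  rw [gaussMoment_add_X_mul_derivative_sq hb1]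
  have hardy := gaussMoment_hardy hb1 (kummerSq b j)
  rw [gaussMoment_derivative_kummerSq_sq hb1] at hardy ⊢
  set A := gaussMoment (2 * b - 1) (kummerSq b j ^ 2)
  set H := gaussMoment (2 * b - 3) (kummerSq b j ^ 2)
  have hc2 : 0 < c ^ 2 := by positivity
  have hKH : (α ^ 2 - α * (2 * b - 2)) * (c ^ 2 * H) ≤ K * ((b - 1) / 2 + j) := by
    have h1 : α ^ 2 - α * (2 * b - 2) = K * (b - 1) ^ 2 := by
      rw [hK, div_mul_cancel₀ _ hb2.ne']
    have h2 : (b - 1) ^ 2 * (c ^ 2 * H) ≤ (b - 1) / 2 + j := by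
      have := mul_le_mul_of_nonneg_left hardy hc2.le
      have e : c ^ 2 * ((b - 1) / 2 * A + j * A) = (b - 1) / 2 + j := by
        linear_combination ((b - 1) / 2 + j) * hnorm
      linarith
    rw [h1, mul_assoc]
    exact mul_le_mul_of_nonneg_left h2 hK0
  have hj : (j : ℝ) ≤ (1 - α) / 2 + |lam j| := by
    have := le_abs_self (lam j)
    rw [hlam] at this ⊢
    linarith
  have hlhs : 1 + c ^ 2 * ((α ^ 2 - α * (2 * b - 2)) * H + α / 2 * A + j * A)
      = 1 + (α ^ 2 - α * (2 * b - 2)) * (c ^ 2 * H) + α / 2 + j := by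
    linear_combination (α / 2 + j) * hnorm
  rw [hlhs]
  have hKj := mul_le_mul_of_nonneg_left hj (by linarith : 0 ≤ K + 1)
  have hL := abs_nonneg (lam j)
  have e₁ := mul_nonneg hKb hL
  have e₂ := mul_nonneg (mul_nonneg (by linarith : 0 ≤ K + 1) (by linarith : 0 ≤ (1 - α) / 2)) hL
  nlinarith
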